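/- Let g ∈ ℤ[x] be x²-divisible of degree d with leading coefficient u_d, and let c ∈ S_g. Then for every n ≥ 30 one has Σ_{p|n} ln|A_{n/p}| ≤ d^{3n/5} · ln(2|u_d|² B̂_0 max{|c|, 4L_g}), the sum being over the distinct prime divisors p of n. -/

import Mathlib

open Polynomial

/-- The `n`-th iterate of `g_c := g + c` applied to `0`, for `g ∈ ℤ[x]` and `c ∈ ℚ`. -/
noncomputable def gcIter (g : ℤ[X]) (c : ℚ) (n : ℕ) : ℚ :=
  (fun x : ℚ => (g.map (Int.castRingHom ℚ)).eval x + c)^[n] 0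

/-- `g` is `x²`-divisible: degree at least 2 and zero constant and linear coefficients. -/
def IsX2Divisible (g : ℤ[X]) : Prop :=
  2 ≤ g.natDegree ∧ g.coeff 0 = 0 ∧ g.coeff 1 = 0

/-- The length `L_g = 1 + ∑_{i=2}^{d-1} |u_i|/|u_d|` of an `x²`-divisible polynomial. -/
noncomputable def Lg (g : ℤ[X]) : ℝ :=
  1 + ∑ i ∈ Finset.Ico 2 g.natDegree, (|g.coeff i| : ℝ) / (|g.leadingCoeff| : ℝ)

/-- `S_g`: the set of `c ∈ ℚ` such that the sequence `{g_c^n(0)}_{n ≥ 1}` takes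
infinitely many values. -/
def Sg (g : ℤ[X]) : Set ℚ :=
  {c : ℚ | (Set.range fun n : ℕ => gcIter g c (n + 1)).Infinite}

/-- The numerator `A_n` of `g_c^{n+1}(0) = g_c^n(c) = A_n / B_n` in lowest terms. -/
noncomputable def An (g : ℤ[X]) (c : ℚ) (n : ℕ) : ℤ := (gcIter g c (n + 1)).num

/-- The (positive) denominator `B_n` of `g_c^{n+1}(0) = g_c^n(c) = A_n / B_n`
in lowest terms. -/
noncomputable def Bn (g : ℤ[X]) (c : ℚ) (n : ℕ) : ℕ := (gcIter g c (n + 1)).den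

/-- For a natural number `a`, the factor `â = ∏_{p ∈ I(a)} p^{val_p(a)}`, where
`I(a)` consists of the primes `p` with `val_p(a) > val_p(u_d)`. -/
noncomputable def hatB (g : ℤ[X]) (a : ℕ) : ℕ :=
  ∏ p ∈ a.primeFactors.filter
      (fun p => padicValInt p g.leadingCoeff < padicValNat p a),
    p ^ padicValNat p a

/-- `g` has rapidly increasing numerators on `S`: there is an integer `N > 0` such that
for every `c ∈ S` there is a finite set `J_c ⊆ ℕ` with `#J_c ≤ N` such that for every
`n ≥ 1` outside `J_c` one has `ln |A_n| > ∑_{p ∣ n} ln |A_{n/p}|`. -/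
def RapidlyIncreasingNumerators (g : ℤ[X]) (S : Set ℚ) : Prop :=
  ∃ N : ℕ, 0 < N ∧ ∀ c ∈ S, ∃ J : Finset ℕ, J.card ≤ N ∧
    ∀ n : ℕ, 1 ≤ n → n ∉ J →
      (∑ p ∈ n.primeFactors, Real.log |(An g c (n / p) : ℝ)|) <
        Real.log |(An g c n : ℝ)|

theorem one_le_abs_leadingCoeff {g : ℤ[X]} (hg : g ≠ 0) : 1 ≤ |(g.leadingCoeff : ℝ)| := by
  exact_mod_cast Int.one_le_abs (leadingCoeff_ne_zero.mpr hg)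

theorem IsX2Divisible.ne_zero {g : ℤ[X]} (hg : IsX2Divisible g) : g ≠ 0 := by
  rintro rfl
  simpa using hg.1

theorem gcIter_succ (g : ℤ[X]) (c : ℚ) (n : ℕ) :
    gcIter g c (n + 1) = (g.map (Int.castRingHom ℚ)).eval (gcIter g c n) + c := by
  simp only [gcIter, Function.iterate_succ_apply']

theorem gcIter_one {g : ℤ[X]} (hg : g.coeff 0 = 0) (c : ℚ) : gcIter g c 1 = c := by
  simp [gcIter, ← coeff_zero_eq_eval_zero, hg]

theorem exists_int_eval_mul_pow_natDegree (g : ℤ[X]) {x : ℚ} {y k : ℤ} (h : x * y = k) :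
    ∃ z : ℤ, (g.map (Int.castRingHom ℚ)).eval x * (y : ℚ) ^ g.natDegree = z := by
  refine ⟨∑ i ∈ Finset.range (g.natDegree + 1),
    g.coeff i * k ^ i * y ^ (g.natDegree - i), ?_⟩
  rw [eval_map, eval₂_eq_sum_range, Finset.sum_mul]
  push_cast
  refine Finset.sum_congr rfl fun i hi => ?_
  have hi : i ≤ g.natDegree := Finset.mem_range_succ_iff.mp hi
  rw [← h, mul_pow, ← Nat.add_sub_cancel' hi, pow_add, Nat.add_sub_cancel' hi]
  simp only [eq_intCast]
  ring

theorem Bn_dvd_pow {g : ℤ[X]} (hg : IsX2Divisible g) (c : ℚ) (n : ℕ) :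
    Bn g c n ∣ Bn g c 0 ^ g.natDegree ^ n := by
  obtain ⟨hd, h0, -⟩ := hg
  have key : ∀ n, ∃ k : ℤ, gcIter g c (n + 1) * (((c.den : ℤ) ^ g.natDegree ^ n : ℤ) : ℚ) = k := by
    intro n
    induction n with
    | zero => exact ⟨c.num, by simp [gcIter_one h0, Rat.mul_den_eq_num]⟩
    | succ n ih =>
      obtain ⟨k, hk⟩ := ih
      obtain ⟨z, hz⟩ := exists_int_eval_mul_pow_natDegree g hk
      obtain ⟨m, hm⟩ : ∃ m, g.natDegree ^ (n + 1) = m + 1 :=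
        Nat.exists_eq_succ_of_ne_zero (by positivity)
      refine ⟨z + c.num * c.den ^ m, ?_⟩
      rw [gcIter_succ, add_mul]
      push_cast at hz ⊢
      rw [← hz, ← Rat.mul_den_eq_num c, ← pow_mul, ← pow_succ, hm]
      ring
  obtain ⟨k, hk⟩ := key n
  have hne : (((c.den : ℤ) ^ g.natDegree ^ n : ℤ) : ℚ) ≠ 0 := by
    exact_mod_cast pow_ne_zero _ c.den_nz
  have hdvd := Rat.den_dvd k ((c.den : ℤ) ^ g.natDegree ^ n)
  rw [Rat.divInt_eq_div, ← hk, mul_div_cancel_right₀ _ hne] at hdvd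
  simp only [Bn, gcIter_one h0]
  exact_mod_cast hdvd

theorem le_natAbs_leadingCoeff_mul_hatB {g : ℤ[X]} (hg : g ≠ 0) {a : ℕ} (ha : a ≠ 0) :
    a ≤ g.leadingCoeff.natAbs * hatB g a := by
  have hu : g.leadingCoeff.natAbs ≠ 0 := by simpa using hg
  set u := g.leadingCoeff.natAbs
  have prod_eq {b : ℕ} (hb : b ≠ 0) : ∏ p ∈ b.primeFactors, p ^ padicValNat p b = b := by
    conv_rhs => rw [← Nat.prod_factorization_pow_eq_self hb]
    refine Finset.prod_congr rfl fun p hp => ?_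
    rw [Nat.factorization_def _ (Nat.prime_of_mem_primeFactors hp)]
  conv_lhs => rw [← prod_eq ha, ← Finset.prod_filter_mul_prod_filter_not a.primeFactors
    (fun p => padicValInt p g.leadingCoeff < padicValNat p a), mul_comm]
  refine Nat.mul_le_mul_right _ ?_
  have hval {p : ℕ} (hp : p ∈ a.primeFactors.filter
      (fun p => ¬ padicValInt p g.leadingCoeff < padicValNat p a)) :
      padicValNat p a ≤ padicValNat p u := not_lt.mp (Finset.mem_filter.mp hp).2
  calc _ ≤ ∏ p ∈ a.primeFactors.filter
        (fun p => ¬ padicValInt p g.leadingCoeff < padicValNat p a), p ^ padicValNat p u :=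
        Finset.prod_le_prod' fun p hp => Nat.pow_le_pow_right
          (Nat.prime_of_mem_primeFactors (Finset.mem_filter.mp hp).1).pos (hval hp)
    _ ≤ ∏ p ∈ u.primeFactors, p ^ padicValNat p u := by
      refine Finset.prod_le_prod_of_subset_of_one_le' (fun p hp => ?_) fun p hp _ =>
        Nat.one_le_pow _ _ (Nat.prime_of_mem_primeFactors hp).pos
      obtain ⟨hpp, hpa, -⟩ := Nat.mem_primeFactors.mp (Finset.mem_filter.mp hp).1
      have := Fact.mk hpp
      refine Nat.mem_primeFactors.mpr ⟨hpp, ?_, hu⟩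
      exact dvd_of_one_le_padicValNat ((one_le_padicValNat_of_dvd ha hpa).trans (hval hp))
    _ = u := prod_eq hu

theorem one_le_Lg (g : ℤ[X]) : 1 ≤ Lg g :=
  le_add_of_nonneg_right (Finset.sum_nonneg fun _ _ => by positivity)

theorem abs_eval_le {g : ℤ[X]} (hg : IsX2Divisible g) {x y : ℝ} (hy : 1 ≤ y) (hxy : |x| ≤ y) :
    |(g.map (Int.castRingHom ℝ)).eval x| ≤ |(g.leadingCoeff : ℝ)| * Lg g * y ^ g.natDegree := by
  have hg0 := hg.ne_zero
  obtain ⟨hd, h0, h1⟩ := hg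
  have hu : |(g.leadingCoeff : ℝ)| ≠ 0 := by simpa using hg0
  have hL : |(g.leadingCoeff : ℝ)| * Lg g =
      ∑ i ∈ Finset.range (g.natDegree + 1), |(g.coeff i : ℝ)| := by
    rw [Finset.sum_range_succ, Finset.range_eq_Ico,
      ← Finset.sum_Ico_consecutive _ (Nat.zero_le 2) hd, Lg, mul_add, Finset.mul_sum]
    simp only [mul_div_cancel₀ _ hu, Finset.sum_range_succ, ← Finset.range_eq_Ico, h0, h1]
    simp only [leadingCoeff, Finset.sum_range_zero, Int.cast_zero, abs_zero]
    ring
  rw [hL, eval_map, eval₂_eq_sum_range, Finset.sum_mul]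
  refine (Finset.abs_sum_le_sum_abs _ _).trans (Finset.sum_le_sum fun i hi => ?_)
  rw [abs_mul, abs_pow, eq_intCast]
  gcongr
  exact (pow_le_pow_left₀ (abs_nonneg _) hxy _).trans
    (pow_le_pow_right₀ hy (Finset.mem_range_succ_iff.mp hi))

theorem abs_gcIter_le {g : ℤ[X]} (hg : IsX2Divisible g) (c : ℚ) {M : ℝ} (hc : |(c : ℝ)| ≤ M)
    (hL : 4 * Lg g ≤ M) (n : ℕ) :
    |(g.leadingCoeff : ℝ)| * M * |(gcIter g c (n + 1) : ℝ)| ≤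
      (|(g.leadingCoeff : ℝ)| * M ^ 2) ^ g.natDegree ^ n := by
  have ha := one_le_abs_leadingCoeff hg.ne_zero
  have hL1 := one_le_Lg g
  set a := |(g.leadingCoeff : ℝ)|
  have hM : 4 ≤ M := by linarith
  have haM : a * M ≤ a * M ^ 2 := by gcongr; nlinarith
  have haM1 : 1 ≤ a * M ^ 2 := by nlinarith
  induction n with
  | zero =>
    rw [gcIter_one hg.2.1, pow_zero, pow_one, pow_two, ← mul_assoc]
    gcongr
  | succ n ih =>
    have hd0 : g.natDegree ^ n ≠ 0 := pow_ne_zero _ (two_pos.trans_le hg.1).ne'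
    set Z := (a * M ^ 2) ^ g.natDegree ^ n with hZ
    have hZ1 : a * M ^ 2 ≤ Z := le_self_pow₀ haM1 hd0
    have haM0 : 0 < a * M := by positivity
    have hy : 1 ≤ Z / (a * M) := by rw [one_le_div haM0]; linarith
    have hx : |(gcIter g c (n + 1) : ℝ)| ≤ Z / (a * M) := by
      rw [le_div_iff₀ haM0]; linarith
    have hev := abs_eval_le hg hy hx
    have hcast : (gcIter g c (n + 1 + 1) : ℝ) =
        (g.map (Int.castRingHom ℝ)).eval (gcIter g c (n + 1) : ℝ) + c := by
      rw [gcIter_succ]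
      simp [eval_map, eval₂_eq_sum_range]
    rw [pow_succ g.natDegree n, pow_mul, ← hZ]
    have hZ16 : 16 ≤ Z := by nlinarith
    have hZd : Z * Z ≤ Z ^ g.natDegree := by
      rw [← pow_two]; exact pow_le_pow_right₀ (by linarith) hg.1
    have haMd : a * M * (a * M) ≤ (a * M) ^ g.natDegree := by
      rw [← pow_two]; exact pow_le_pow_right₀ (by nlinarith) hg.1
    have hmain : a * M * (a * Lg g * (Z / (a * M)) ^ g.natDegree) ≤ Z ^ g.natDegree / 4 := by
      rw [div_pow, ← mul_div_assoc, ← mul_div_assoc, div_le_div_iff₀ (by positivity) (by norm_num)]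
      have : a * M * (a * Lg g) * 4 ≤ (a * M) ^ g.natDegree := by
        refine le_trans ?_ haMd
        have : 0 < a * (a * M) := by positivity
        nlinarith
      have hZp : 0 ≤ Z ^ g.natDegree := by positivity
      nlinarith
    calc a * M * |(gcIter g c (n + 1 + 1) : ℝ)|
        ≤ a * M * (a * Lg g * (Z / (a * M)) ^ g.natDegree + M) := by
          rw [hcast]
          gcongr
          exact (abs_add_le _ _).trans (add_le_add hev hc)
      _ ≤ Z ^ g.natDegree / 4 + a * M ^ 2 := by nlinarith
      _ ≤ Z ^ g.natDegree := by nlinarith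

theorem one_le_hatB (g : ℤ[X]) (a : ℕ) : 1 ≤ hatB g a :=
  Finset.one_le_prod' fun _ hp =>
    Nat.one_le_pow _ _ (Nat.prime_of_mem_primeFactors (Finset.mem_filter.mp hp).1).pos

theorem one_le_two_mul_sq_leadingCoeff_mul {g : ℤ[X]} (hg : g ≠ 0) (c : ℝ) (a : ℕ) :
    1 ≤ 2 * (g.leadingCoeff : ℝ) ^ 2 * (hatB g a : ℝ) * max |c| (4 * Lg g) := by
  have h1 : 1 ≤ (g.leadingCoeff : ℝ) ^ 2 := by
    rw [← sq_abs]; exact one_le_pow₀ (one_le_abs_leadingCoeff hg)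
  have h2 : (1 : ℝ) ≤ hatB g a := by exact_mod_cast one_le_hatB g a
  have h3 : 1 ≤ max |c| (4 * Lg g) := le_trans (by linarith [one_le_Lg g]) (le_max_right _ _)
  exact one_le_mul_of_one_le_of_one_le (one_le_mul_of_one_le_of_one_le (by linarith) h2) h3

theorem log_abs_An_le {g : ℤ[X]} (hg : IsX2Divisible g) (c : ℚ) (n : ℕ) :
    Real.log |(An g c n : ℝ)| ≤ 2 * g.natDegree ^ n *
      Real.log (2 * (g.leadingCoeff : ℝ) ^ 2 * (hatB g (Bn g c 0) : ℝ) *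
        max |(c : ℝ)| (4 * Lg g)) := by
  have hg0 := hg.ne_zero
  have hx := abs_gcIter_le hg c (le_max_left _ (4 * Lg g)) (le_max_right _ _) n
  have hQ := one_le_two_mul_sq_leadingCoeff_mul hg0 c (Bn g c 0)
  have hM : 4 ≤ max |(c : ℝ)| (4 * Lg g) :=
    le_trans (by linarith [one_le_Lg g]) (le_max_right _ _)
  set M := max |(c : ℝ)| (4 * Lg g)
  have ha := one_le_abs_leadingCoeff hg0
  have hB0 : (Bn g c 0 : ℝ) ≤ |(g.leadingCoeff : ℝ)| * hatB g (Bn g c 0) := by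
    have := le_natAbs_leadingCoeff_mul_hatB hg0 (a := Bn g c 0) (Rat.den_nz _)
    rw [← Int.cast_abs, ← Int.natCast_natAbs, Int.cast_natCast]
    exact_mod_cast this
  have hb : (1 : ℝ) ≤ hatB g (Bn g c 0) := by
    exact_mod_cast one_le_hatB g _
  set b : ℝ := (hatB g (Bn g c 0) : ℝ)
  rw [← sq_abs (g.leadingCoeff : ℝ)] at hQ ⊢
  set a := |(g.leadingCoeff : ℝ)|
  have hBn : (Bn g c n : ℝ) ≤ (a * b) ^ g.natDegree ^ n := by
    have h1 : Bn g c n ≤ Bn g c 0 ^ g.natDegree ^ n :=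
      Nat.le_of_dvd (pow_pos (Rat.den_pos _) _) (Bn_dvd_pow hg c n)
    calc (Bn g c n : ℝ) ≤ (Bn g c 0 : ℝ) ^ g.natDegree ^ n := by exact_mod_cast h1
      _ ≤ _ := by gcongr
  have hA : (An g c n : ℝ) = gcIter g c (n + 1) * Bn g c n := by
    rw [An, Bn]; exact_mod_cast (Rat.mul_den_eq_num _).symm
  have hxn : |(gcIter g c (n + 1) : ℝ)| ≤ (a * M ^ 2) ^ g.natDegree ^ n :=
    le_trans (le_mul_of_one_le_left (abs_nonneg _) (by nlinarith)) hx
  have hbound : |(An g c n : ℝ)| ≤ (2 * a ^ 2 * b * M) ^ (2 * g.natDegree ^ n) := by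
    calc |(An g c n : ℝ)| = |(gcIter g c (n + 1) : ℝ)| * Bn g c n := by
          rw [hA, abs_mul, Nat.abs_cast]
      _ ≤ (a * M ^ 2) ^ g.natDegree ^ n * (a * b) ^ g.natDegree ^ n := by gcongr
      _ = (a ^ 2 * b * M ^ 2) ^ g.natDegree ^ n := by rw [← mul_pow]; ring
      _ ≤ ((2 * a ^ 2 * b * M) ^ 2) ^ g.natDegree ^ n := by
        gcongr
        have h1 : 1 ≤ a ^ 2 * b := one_le_mul_of_one_le_of_one_le (one_le_pow₀ ha) hb
        have h2 : a ^ 2 * b ≤ (a ^ 2 * b) ^ 2 := by nlinarith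
        calc a ^ 2 * b * M ^ 2 ≤ 4 * ((a ^ 2 * b) ^ 2 * M ^ 2) := by
              have : 0 ≤ M ^ 2 := sq_nonneg M
              nlinarith
          _ = (2 * a ^ 2 * b * M) ^ 2 := by ring
      _ = _ := by rw [← pow_mul]
  rcases (abs_nonneg (An g c n : ℝ)).eq_or_lt with h | h
  · rw [← h, Real.log_zero]
    have := Real.log_nonneg hQ
    positivity
  · refine (Real.log_le_log h hbound).trans_eq ?_
    rw [Real.log_pow]
    push_cast
    ring

theorem two_mul_sum_pow_div_primeFactors_le {d n : ℕ} (hd : 2 ≤ d) (hn : 20 ≤ n) :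
    2 * ∑ p ∈ n.primeFactors, (d : ℝ) ^ (n / p) ≤ (d : ℝ) ^ ((3 * n : ℝ) / 5) := by
  have hinj : Set.InjOn (fun p => n / p) (n.primeFactors : Set ℕ) := by
    intro p hp q hq h
    have hp := Nat.dvd_of_mem_primeFactors hp
    have hq := Nat.dvd_of_mem_primeFactors hq
    have h : n / p = n / q := h
    rw [← Nat.div_div_self hp (by omega), h, Nat.div_div_self hq (by omega)]
  have hsum : ∑ p ∈ n.primeFactors, d ^ (n / p) < d ^ (n / 2 + 1) := by
    rw [← Finset.sum_image (f := fun k => d ^ k) hinj]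
    refine Nat.geomSum_lt hd fun k hk => ?_
    obtain ⟨p, hp, rfl⟩ := Finset.mem_image.mp hk
    exact Nat.lt_succ_of_le
      (Nat.div_le_div_left (Nat.prime_of_mem_primeFactors hp).two_le two_pos)
  have hnat : 2 * ∑ p ∈ n.primeFactors, d ^ (n / p) ≤ d ^ (n / 2 + 2) := by
    rw [pow_succ' d (n / 2 + 1)]
    exact Nat.mul_le_mul hd hsum.le
  have hd1 : (1 : ℝ) ≤ d := by exact_mod_cast one_le_two.trans hd
  calc 2 * ∑ p ∈ n.primeFactors, (d : ℝ) ^ (n / p) ≤ (d : ℝ) ^ (n / 2 + 2) := by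
        exact_mod_cast hnat
    _ = (d : ℝ) ^ ((n / 2 + 2 : ℕ) : ℝ) := (Real.rpow_natCast _ _).symm
    _ ≤ _ := by
      refine Real.rpow_le_rpow_of_exponent_le hd1 ?_
      have h1 : ((n / 2 : ℕ) : ℝ) ≤ n / 2 := Nat.cast_div_le
      have h2 : (20 : ℝ) ≤ n := by exact_mod_cast hn
      push_cast
      linarith

/-- Lemma 3.2: for `c ∈ S_g` and `n ≥ 30`,
`∑_{p ∣ n} ln |A_{n/p}| ≤ d^{3n/5} · ln (2 u_d² B̂_0 max{|c|, 4 L_g})`. -/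
theorem sum_log_num_upper_bound (g : ℤ[X]) (hg : IsX2Divisible g)
    (c : ℚ) (hc : c ∈ Sg g) (n : ℕ) (hn : 30 ≤ n) :
    (∑ p ∈ n.primeFactors, Real.log |(An g c (n / p) : ℝ)|) ≤
      (g.natDegree : ℝ) ^ ((3 * n : ℝ) / 5) *
        Real.log (2 * (g.leadingCoeff : ℝ) ^ 2 * (hatB g (Bn g c 0) : ℝ) *
          max |(c : ℝ)| (4 * Lg g)) := by
  have hQ : 0 ≤ Real.log (2 * (g.leadingCoeff : ℝ) ^ 2 * (hatB g (Bn g c 0) : ℝ) *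
      max |(c : ℝ)| (4 * Lg g)) :=
    Real.log_nonneg (one_le_two_mul_sq_leadingCoeff_mul hg.ne_zero c _)
  calc _ ≤ ∑ p ∈ n.primeFactors, 2 * (g.natDegree : ℝ) ^ (n / p) * _ :=
        Finset.sum_le_sum fun p _ => log_abs_An_le hg c (n / p)
    _ = (2 * ∑ p ∈ n.primeFactors, (g.natDegree : ℝ) ^ (n / p)) * _ := by
        rw [← Finset.sum_mul, ← Finset.mul_sum]
    _ ≤ _ := mul_le_mul_of_nonneg_right
        (two_mul_sum_pow_div_primeFactors_le hg.1 (by omega)) hQ
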